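/- arXiv:math-ph/0103025 — 2 statements merged into one kernel-verified Lean document; each statement's English description precedes it below -/
import Mathlib

section
/- For a positive integer N, define G_{N+1}(s) := ∫_{(−∞,s]^{N+1}} ∏_{j=1}^{N+1} e^{−x_j²} ∏_{1≤j<k≤N+1}(x_k − x_j)² dx and R_{N+1}(s) := G_{N+1}'(s)/G_{N+1}(s), and define D_N(s;2) := ∫_{(−∞,s]^N} ∏_{j=1}^N e^{−x_j²}(s − x_j)² ∏_{1≤j<k≤N}(x_k − x_j)² dx and U_N(s;2) := (d/ds) log D_N(s;2). Then R_{N+1}(s) > 0 for all s and the identity U_N(s;2) = 2s + R_{N+1}(s) + R_{N+1}'(s)/R_{N+1}(s) holds for all real s. -/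
open MeasureTheory

/-- The truncated Gaussian moment `∫_{-∞}^s e^{-x²} x^m dx`. -/
noncomputable def gaussMoment (m : ℕ) (s : ℝ) : ℝ :=
  ∫ x in Set.Iic s, Real.exp (-x ^ 2) * x ^ m

/-- The integral of a polynomial against the Gaussian weight over `(-∞, s]^n`. -/
noncomputable def gaussIntegral {n : ℕ} (p : MvPolynomial (Fin n) ℝ) (s : ℝ) : ℝ :=
  ∫ x in Set.univ.pi fun _ : Fin n => Set.Iic s,
    (∏ j, Real.exp (-(x j) ^ 2)) * MvPolynomial.eval x p

/-- The polynomial obtained by setting the `j`-th variable equal to `s`. -/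
noncomputable def specializeAt {n : ℕ} (j : Fin (n + 1)) (s : ℝ)
    (p : MvPolynomial (Fin (n + 1)) ℝ) : MvPolynomial (Fin n) ℝ :=
  MvPolynomial.bind₁ (j.insertNth (MvPolynomial.C s) MvPolynomial.X) p

/-- The squared Vandermonde product as a polynomial. -/
noncomputable def vandermondeSq (n : ℕ) : MvPolynomial (Fin n) ℝ :=
  ∏ j, ∏ k ∈ Finset.Ioi j, (MvPolynomial.X k - MvPolynomial.X j) ^ 2

lemma integrable_exp_neg_sq_mul_pow (m : ℕ) :
    Integrable fun x : ℝ => Real.exp (-x ^ 2) * x ^ m := by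
  have h := integrable_rpow_mul_exp_neg_mul_sq one_pos (s := m)
    (neg_one_lt_zero.trans_le m.cast_nonneg)
  simpa [mul_comm] using h

lemma hasDerivAt_gaussMoment (m : ℕ) (s : ℝ) :
    HasDerivAt (gaussMoment m) (Real.exp (-s ^ 2) * s ^ m) s := by
  have hi := integrable_exp_neg_sq_mul_pow m
  have hc : Continuous fun x : ℝ => Real.exp (-x ^ 2) * x ^ m := by fun_prop
  have h : gaussMoment m = fun t =>
      gaussMoment m 0 + ∫ x in (0 : ℝ)..t, Real.exp (-x ^ 2) * x ^ m := by
    funext t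
    rw [← intervalIntegral.integral_Iic_sub_Iic hi.integrableOn hi.integrableOn]
    simp [gaussMoment]
  rw [h]
  exact (hc.integral_hasStrictDerivAt 0 s).hasDerivAt.const_add _

lemma eval_specializeAt {n : ℕ} (j : Fin (n + 1)) (s : ℝ) (p : MvPolynomial (Fin (n + 1)) ℝ)
    (y : Fin n → ℝ) :
    MvPolynomial.eval y (specializeAt j s p) =
      MvPolynomial.eval (j.insertNth s y : Fin (n + 1) → ℝ) p := by
  have h := MvPolynomial.eval₂Hom_bind₁ (RingHom.id ℝ) y
    (j.insertNth (MvPolynomial.C s) MvPolynomial.X) p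
  refine h.trans ?_
  congr 2
  funext i
  refine j.succAboveCases ?_ (fun k => ?_) i <;> simp

lemma specializeAt_add {n : ℕ} (j : Fin (n + 1)) (s : ℝ) (p q : MvPolynomial (Fin (n + 1)) ℝ) :
    specializeAt j s (p + q) = specializeAt j s p + specializeAt j s q :=
  map_add _ p q

lemma weight_mul_eval_monomial {n : ℕ} (u : Fin n →₀ ℕ) (a : ℝ) (x : Fin n → ℝ) :
    (∏ j, Real.exp (-(x j) ^ 2)) * MvPolynomial.eval x (MvPolynomial.monomial u a) =
      a * ∏ j, (Real.exp (-(x j) ^ 2) * x j ^ u j) := by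
  rw [MvPolynomial.eval_monomial, Finsupp.prod_fintype _ _ (fun _ => pow_zero _),
    Finset.prod_mul_distrib]
  ring

lemma integrable_weight_mul_eval {n : ℕ} (p : MvPolynomial (Fin n) ℝ) :
    Integrable fun x : Fin n → ℝ =>
      (∏ j, Real.exp (-(x j) ^ 2)) * MvPolynomial.eval x p := by
  induction p using MvPolynomial.induction_on' with
  | monomial u a =>
    simp_rw [weight_mul_eval_monomial]
    exact (Integrable.fintype_prod fun j => integrable_exp_neg_sq_mul_pow (u j)).const_mul a
  | add p q hp hq =>
    simp_rw [map_add, mul_add]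
    exact hp.add hq

lemma gaussIntegral_monomial {n : ℕ} (u : Fin n →₀ ℕ) (a s : ℝ) :
    gaussIntegral (MvPolynomial.monomial u a) s = a * ∏ j, gaussMoment (u j) s := by
  simp_rw [gaussIntegral, weight_mul_eval_monomial, gaussMoment]
  rw [integral_const_mul, volume_pi, Measure.restrict_pi_pi]
  congr 1
  exact integral_fintype_prod_eq_prod fun (j : Fin n) x => Real.exp (-x ^ 2) * x ^ u j

lemma gaussIntegral_add {n : ℕ} (p q : MvPolynomial (Fin n) ℝ) (s : ℝ) :
    gaussIntegral (p + q) s = gaussIntegral p s + gaussIntegral q s := by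
  simp_rw [gaussIntegral, map_add, mul_add]
  exact integral_add (integrable_weight_mul_eval p).integrableOn
    (integrable_weight_mul_eval q).integrableOn

lemma gaussIntegral_specializeAt_monomial {n : ℕ} (j : Fin (n + 1)) (u : Fin (n + 1) →₀ ℕ)
    (a t s : ℝ) :
    gaussIntegral (specializeAt j t (MvPolynomial.monomial u a)) s =
      a * t ^ u j * ∏ k, gaussMoment (u (j.succAbove k)) s := by
  have h (y : Fin n → ℝ) :
      MvPolynomial.eval y (specializeAt j t (MvPolynomial.monomial u a)) =
        MvPolynomial.eval y (MvPolynomial.monomial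
          (Finsupp.equivFunOnFinite.symm fun k => u (j.succAbove k)) (a * t ^ u j)) := by
    rw [eval_specializeAt, MvPolynomial.eval_monomial, MvPolynomial.eval_monomial,
      Finsupp.prod_fintype _ _ (fun _ => pow_zero _),
      Finsupp.prod_fintype _ _ (fun _ => pow_zero _), Fin.prod_univ_succAbove _ j]
    simp [mul_assoc]
  rw [MvPolynomial.funext h, gaussIntegral_monomial]
  rfl

/-- Differentiating with respect to the common upper endpoint produces one boundary term for each
variable. -/
lemma hasDerivAt_gaussIntegral {n : ℕ} (p : MvPolynomial (Fin (n + 1)) ℝ) (s : ℝ) :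
    HasDerivAt (gaussIntegral p)
      (∑ j, Real.exp (-s ^ 2) * gaussIntegral (specializeAt j s p) s) s := by
  induction p using MvPolynomial.induction_on' with
  | monomial u a =>
    have h := (HasDerivAt.fun_finsetProd (u := Finset.univ) fun j _ =>
      hasDerivAt_gaussMoment (u j) s).const_mul a
    rw [funext (gaussIntegral_monomial u a)]
    refine h.congr_deriv ?_
    rw [Finset.mul_sum]
    refine Finset.sum_congr rfl fun j _ => ?_
    rw [gaussIntegral_specializeAt_monomial, ← Finset.compl_singleton,
      ← Fin.image_succAbove_univ, Finset.prod_image fun _ _ _ _ h => j.succAbove_right_injective h,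
      smul_eq_mul]
    ring
  | add p q hp hq =>
    rw [funext (gaussIntegral_add p q)]
    refine (hp.add hq).congr_deriv ?_
    simp_rw [specializeAt_add, gaussIntegral_add, mul_add, Finset.sum_add_distrib]

lemma differentiable_gaussIntegral_specializeAt {n : ℕ} (j : Fin (n + 1))
    (p : MvPolynomial (Fin (n + 1)) ℝ) :
    Differentiable ℝ fun s => gaussIntegral (specializeAt j s p) s := by
  induction p using MvPolynomial.induction_on' with
  | monomial u a =>
    simp_rw [gaussIntegral_specializeAt_monomial]
    have h (m : ℕ) : Differentiable ℝ (gaussMoment m) := fun s =>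
      (hasDerivAt_gaussMoment m s).differentiableAt
    fun_prop
  | add p q hp hq =>
    simp_rw [specializeAt_add, gaussIntegral_add]
    exact hp.add hq

lemma gaussIntegral_pos {n : ℕ} {p : MvPolynomial (Fin n) ℝ} {s : ℝ}
    (hp : ∀ x, 0 ≤ MvPolynomial.eval x p) {x₀ : Fin n → ℝ} (hx₀ : ∀ j, x₀ j < s)
    (hpx₀ : MvPolynomial.eval x₀ p ≠ 0) : 0 < gaussIntegral p s := by
  have hw (x : Fin n → ℝ) : 0 < ∏ j, Real.exp (-(x j) ^ 2) :=
    Finset.prod_pos fun _ _ => Real.exp_pos _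
  rw [gaussIntegral, setIntegral_pos_iff_support_of_nonneg_ae
    (Filter.Eventually.of_forall fun x => mul_nonneg (hw x).le (hp x))
    (integrable_weight_mul_eval p).integrableOn]
  have ho : IsOpen ({x | MvPolynomial.eval x p ≠ 0} ∩
      Set.univ.pi fun _ : Fin n => Set.Iio s) :=
    (isOpen_ne_fun p.continuous_eval continuous_const).inter
      (isOpen_set_pi Set.finite_univ fun _ _ => isOpen_Iio)
  refine (ho.measure_pos volume ⟨x₀, hpx₀, fun j _ => hx₀ j⟩).trans_le (measure_mono ?_)
  exact fun x hx => ⟨mul_ne_zero (hw x).ne' hx.1, fun j hj => Set.Iio_subset_Iic_self (hx.2 j hj)⟩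

lemma eval_vandermondeSq {n : ℕ} (x : Fin n → ℝ) :
    MvPolynomial.eval x (vandermondeSq n) = ∏ j, ∏ k ∈ Finset.Ioi j, (x k - x j) ^ 2 := by
  simp [vandermondeSq, map_prod]

lemma eval_vandermondeSq_eq_det_sq {n : ℕ} (x : Fin n → ℝ) :
    MvPolynomial.eval x (vandermondeSq n) = (Matrix.vandermonde x).det ^ 2 := by
  simp_rw [eval_vandermondeSq, Matrix.det_vandermonde, ← Finset.prod_pow]

lemma eval_vandermondeSq_comp_perm {n : ℕ} (x : Fin n → ℝ) (σ : Equiv.Perm (Fin n)) :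
    MvPolynomial.eval (x ∘ σ) (vandermondeSq n) = MvPolynomial.eval x (vandermondeSq n) := by
  have h : Matrix.vandermonde (x ∘ σ) = (Matrix.vandermonde x).submatrix σ id := rfl
  rw [eval_vandermondeSq_eq_det_sq, eval_vandermondeSq_eq_det_sq, h, Matrix.det_permute, mul_pow]
  rcases Int.units_eq_one_or (Equiv.Perm.sign σ) with h | h <;> simp [h]

lemma eval_specializeAt_vandermondeSq {n : ℕ} (j : Fin (n + 1)) (s : ℝ) (y : Fin n → ℝ) :
    MvPolynomial.eval y (specializeAt j s (vandermondeSq (n + 1))) =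
      (∏ k, (s - y k) ^ 2) * ∏ j, ∏ k ∈ Finset.Ioi j, (y k - y j) ^ 2 := by
  rw [eval_specializeAt, ← Fin.cons_comp_cycleRange, eval_vandermondeSq_comp_perm,
    eval_vandermondeSq, Fin.prod_univ_succ]
  simp only [Fin.prod_Ioi_zero, Fin.prod_Ioi_succ, Fin.cons_zero, Fin.cons_succ]
  simp_rw [sub_sq_comm s]

lemma eval_vandermondeSq_ne_zero {n : ℕ} {x : Fin n → ℝ} (hx : Function.Injective x) :
    MvPolynomial.eval x (vandermondeSq n) ≠ 0 := by
  rw [eval_vandermondeSq_eq_det_sq]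
  exact pow_ne_zero 2 (Matrix.det_vandermonde_ne_zero_iff.mpr hx)

lemma exists_injective_forall_lt (n : ℕ) (s : ℝ) :
    ∃ x : Fin n → ℝ, Function.Injective x ∧ ∀ j, x j < s := by
  refine ⟨fun j => s - 1 - (j : ℕ), fun i j h => ?_, fun j => ?_⟩
  · have h' : ((i : ℕ) : ℝ) = (j : ℕ) := by simpa using h
    exact Fin.ext (by exact_mod_cast h')
  · have : (0 : ℝ) ≤ (j : ℕ) := Nat.cast_nonneg _
    linarith

lemma gaussIntegral_vandermondeSq_pos (n : ℕ) (s : ℝ) :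
    0 < gaussIntegral (vandermondeSq n) s := by
  obtain ⟨x, hx, hxs⟩ := exists_injective_forall_lt n s
  refine gaussIntegral_pos (fun y => ?_) hxs (eval_vandermondeSq_ne_zero hx)
  rw [eval_vandermondeSq_eq_det_sq]
  positivity

lemma gaussIntegral_specializeAt_vandermondeSq_pos {n : ℕ} (j : Fin (n + 1)) (s : ℝ) :
    0 < gaussIntegral (specializeAt j s (vandermondeSq (n + 1))) s := by
  obtain ⟨x, hx, hxs⟩ := exists_injective_forall_lt n s
  refine gaussIntegral_pos (fun y => ?_) hxs ?_
  · rw [eval_specializeAt, eval_vandermondeSq_eq_det_sq]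
    positivity
  · rw [eval_specializeAt_vandermondeSq, ← eval_vandermondeSq]
    exact mul_ne_zero (Finset.prod_ne_zero_iff.mpr fun k _ =>
      pow_ne_zero 2 (sub_pos.mpr (hxs k)).ne') (eval_vandermondeSq_ne_zero hx)

/-- The derivative of the gap-probability integral is proportional to `e^{-s²}` times the
average of the squared characteristic polynomial. -/
lemma hasDerivAt_gaussIntegral_vandermondeSq (n : ℕ) (s : ℝ) :
    HasDerivAt (gaussIntegral (vandermondeSq (n + 1)))
      ((n + 1) * Real.exp (-s ^ 2) *
        gaussIntegral (specializeAt 0 s (vandermondeSq (n + 1))) s) s := by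
  refine (hasDerivAt_gaussIntegral (vandermondeSq (n + 1)) s).congr_deriv ?_
  have h (j : Fin (n + 1)) : specializeAt j s (vandermondeSq (n + 1)) =
      specializeAt 0 s (vandermondeSq (n + 1)) :=
    MvPolynomial.funext fun y => by simp_rw [eval_specializeAt_vandermondeSq]
  simp [h, mul_assoc]

/-- Identity relating the logarithmic derivative `U_N(s;2)` of
`D_N(s;2) = ∫_{(-∞,s]^N} ∏ e^{-x_j²}(s-x_j)² ∏_{j<k}(x_k-x_j)² dx` and the
logarithmic derivative `R_{N+1}` of the `(N+1)`-dimensional gap-probability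
integral: `U_N(s;2) = 2s + R_{N+1}(s) + R_{N+1}'(s)/R_{N+1}(s)`. -/
theorem U_R_identity (N : ℕ) (hN : 0 < N)
    (G R D U : ℝ → ℝ)
    (hG : ∀ s, G s = ∫ x in Set.univ.pi fun _ : Fin (N + 1) => Set.Iic s,
        (∏ j, Real.exp (-(x j) ^ 2)) * ∏ j, ∏ k ∈ Finset.Ioi j, (x k - x j) ^ 2)
    (hR : ∀ s, R s = deriv G s / G s)
    (hD : ∀ s, D s = ∫ x in Set.univ.pi fun _ : Fin N => Set.Iic s,
        (∏ j, Real.exp (-(x j) ^ 2) * (s - x j) ^ 2)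
          * ∏ j, ∏ k ∈ Finset.Ioi j, (x k - x j) ^ 2)
    (hU : ∀ s, U s = deriv D s / D s) :
    (∀ s, 0 < R s) ∧ ∀ s, U s = 2 * s + R s + deriv R s / R s := by
  have hG' : G = gaussIntegral (vandermondeSq (N + 1)) := by
    funext s
    simp_rw [hG, gaussIntegral, eval_vandermondeSq]
  have hD' : D = fun s => gaussIntegral (specializeAt 0 s (vandermondeSq (N + 1))) s := by
    funext s
    simp_rw [hD, gaussIntegral, eval_specializeAt_vandermondeSq, Finset.prod_mul_distrib, mul_assoc]
  have hGpos (s : ℝ) : 0 < G s := hG' ▸ gaussIntegral_vandermondeSq_pos (N + 1) s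
  have hDpos (s : ℝ) : 0 < D s := hD' ▸ gaussIntegral_specializeAt_vandermondeSq_pos 0 s
  have hGderiv (s : ℝ) : HasDerivAt G ((N + 1) * Real.exp (-s ^ 2) * D s) s := by
    rw [hG', hD']
    exact hasDerivAt_gaussIntegral_vandermondeSq N s
  have hDdiff (s : ℝ) : HasDerivAt D (deriv D s) s := by
    have h : Differentiable ℝ D := hD' ▸ differentiable_gaussIntegral_specializeAt 0 _
    exact (h s).hasDerivAt
  have hReq : R = fun s => (N + 1) * Real.exp (-s ^ 2) * D s / G s := by
    funext s
    rw [hR, (hGderiv s).deriv]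
  have hRpos (s : ℝ) : 0 < R s := by
    have := hGpos s
    have := hDpos s
    rw [hReq]
    positivity
  refine ⟨hRpos, fun s => ?_⟩
  have hexp : HasDerivAt (fun t : ℝ => (N + 1) * Real.exp (-t ^ 2))
      ((N + 1) * (Real.exp (-s ^ 2) * -(2 * s))) s := by
    simpa using ((hasDerivAt_pow 2 s).neg.exp.const_mul ((N : ℝ) + 1))
  have hRderiv := ((hexp.fun_mul (hDdiff s)).fun_div (hGderiv s) (hGpos s).ne').deriv
  have hG0 := (hGpos s).ne'
  have hD0 := (hDpos s).ne'
  have hN0 : (N : ℝ) + 1 ≠ 0 := by positivity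
  have hE0 := (Real.exp_pos (-s ^ 2)).ne'
  rw [hU, hReq, hRderiv]
  field_simp
  ring
end

section
/- Let α₁ be a real number and let q, p : ℝ → ℝ be differentiable functions satisfying q'(t) = p(t) − q(t)² − t/2 and p'(t) = 2q(t)p(t) + α₁. Define the Hamiltonian function h(t) := −(1/2)(2q(t)² + t − p(t))p(t) − α₁q(t). Then h is twice differentiable and satisfies the Jimbo–Miwa–Okamoto σ-form of the Painlevé II equation: (h''(t))² + 4(h'(t))³ + 2h'(t)(t·h'(t) − h(t)) − α₁²/4 = 0 for all t. -/
/-- The PII Hamiltonian `h(t) = -(1/2)(2q² + t - p)p - α₁q`, evaluated along a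
solution of Hamilton's equations, satisfies the Jimbo–Miwa–Okamoto σ-form of PII:
`(h'')² + 4(h')³ + 2h'(th' - h) - α₁²/4 = 0`. -/
theorem PII_Hamiltonian_satisfies_sigma_form
    (α₁ : ℝ) (q p : ℝ → ℝ)
    (hq : Differentiable ℝ q) (hp : Differentiable ℝ p)
    (heq : ∀ t, deriv q t = p t - (q t) ^ 2 - t / 2)
    (hep : ∀ t, deriv p t = 2 * q t * p t + α₁)
    (h : ℝ → ℝ)
    (hh : h = fun t => -(1 / 2) * (2 * (q t) ^ 2 + t - p t) * p t - α₁ * q t) :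
    Differentiable ℝ h ∧ Differentiable ℝ (deriv h) ∧
    ∀ t, (deriv (deriv h) t) ^ 2 + 4 * (deriv h t) ^ 3
        + 2 * deriv h t * (t * deriv h t - h t) - α₁ ^ 2 / 4 = 0 := by
  have hqd : ∀ t, HasDerivAt q (p t - (q t) ^ 2 - t / 2) t := fun t =>
    heq t ▸ (hq t).hasDerivAt
  have hpd : ∀ t, HasDerivAt p (2 * q t * p t + α₁) t := fun t =>
    hep t ▸ (hp t).hasDerivAt
  have hd : ∀ t, HasDerivAt h (-(1 / 2) * p t) t := by
    intro t
    rw [hh]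
    refine HasDerivAt.congr_deriv
      (((((((hqd t).pow 2).const_mul 2).add (hasDerivAt_id t)).sub (hpd t)).const_mul
        (-(1 / 2))).mul (hpd t) |>.sub ((hqd t).const_mul α₁)) ?_
    simp
    ring
  have hderiv : deriv h = fun t => -(1 / 2) * p t := funext fun t => (hd t).deriv
  have hdd : ∀ t, HasDerivAt (deriv h) (-(1 / 2) * (2 * q t * p t + α₁)) t := by
    intro t
    rw [hderiv]
    exact (hpd t).const_mul _
  refine ⟨fun t => (hd t).differentiableAt, fun t => (hdd t).differentiableAt, fun t => ?_⟩
  rw [(hdd t).deriv, (hd t).deriv, hh]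
  ring
end
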